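/- Let σ ∈ S_m and τ ∈ S_n with GC(σ) = I and GC(τ) = J, and let K be a composition of m+n. Write K = K'·K'' or K = K'▷K'' with |K'| = m (concatenation or near-concatenation gluing the last part of K' with the first part of K''). If K' is coarser than I and K'' is finer than J, then the number of permutations μ in the shifted shuffle σ ⋒ τ with GC(μ) = K equals the binomial coefficient C(m + ℓ(J) − ℓ(I), ℓ(K) − ℓ(I)); otherwise this number is 0. -/

import Mathlib

/-- Descent set of a composition `I` (list of parts): partial sums except the total. -/
def descSetC (I : List ℕ) : Finset ℕ :=
  ((I.scanl (· + ·) 0).tail.dropLast).toFinset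

/-- `I` is a composition of `n`: positive parts summing to `n`. -/
def IsComp (n : ℕ) (I : List ℕ) : Prop :=
  (∀ i ∈ I, 0 < i) ∧ I.sum = n

/-- The composition of `n` whose descent set is `D ⊆ {1,…,n-1}`. -/
def compOfDescSet (n : ℕ) (D : Finset ℕ) : List ℕ :=
  let s := (D.sort (· ≤ ·)) ++ [n]
  (List.zipWith (fun a b => a - b) s (0 :: s)).filter (fun x => 0 < x)
/-- Genocchi descent set of a word in one-line notation: the set of values
immediately followed by a smaller value. -/
def GDes (l : List ℕ) : Finset ℕ :=
  ((Finset.range l.length).filter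
    (fun j => j + 1 < l.length ∧ l.getD (j+1) 0 < l.getD j 0)).image (fun j => l.getD j 0)

/-- Genocchi composition of a permutation of `{1,…,n}`: the composition of `n`
whose descent set is `{d - 1 : d ∈ GDes}`. -/
def GComp (n : ℕ) (l : List ℕ) : List ℕ :=
  compOfDescSet n ((GDes l).image (· - 1))
/-- All shuffles of two words (as a list with multiplicities). -/
def shuffles : List ℕ → List ℕ → List (List ℕ)
  | [], v => [v]
  | u, [] => [u]
  | a :: u, b :: v =>
      (shuffles u (b :: v)).map (a :: ·) ++ (shuffles (a :: u) v).map (b :: ·)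
  termination_by u v => u.length + v.length

/-- Shifted shuffle of `σ ∈ S_m` with `τ ∈ S_n`: shuffles of `σ` with `τ[m]`. -/
def shiftShuffle (m : ℕ) (σ τ : List ℕ) : List (List ℕ) :=
  shuffles σ (τ.map (· + m))

/-- Integer binomial coefficient `C(a,b)`, `0` when `b < 0` or `b > a`. -/
def Cz (a b : ℤ) : ℤ := if 0 ≤ b ∧ b ≤ a then (a.toNat.choose b.toNat : ℤ) else 0

/-- Near-concatenation `K' ▷ K''`: glue the last part of `K'` with the first
part of `K''`. -/
def nearConcat (A B : List ℕ) : List ℕ :=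
  A.dropLast ++ (A.getLastD 0 + B.headD 0) :: B.tail

/-- `goodWord D w`: every letter of `w` is in `D` exactly when it is followed by a smaller letter. -/
def goodWord (D : Finset ℕ) : List ℕ → Bool
  | [] => true
  | [a] => decide (a ∉ D)
  | a :: b :: l => decide (b < a ↔ a ∈ D) && goodWord D (b :: l)

/-- Every letter of the word lying in `D` is followed by a smaller letter. -/
def descentsCover (D : Finset ℕ) : List ℕ → Bool
  | [] => true
  | [a] => decide (a ∉ D)
  | a :: b :: l => decide (a ∈ D → b < a) && descentsCover D (b :: l)

/-- Every letter of the word followed by a smaller letter lies in `D`. -/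
def descentsWithin (D : Finset ℕ) : List ℕ → Bool
  | [] => true
  | [_] => true
  | a :: b :: l => decide (b < a → a ∈ D) && descentsWithin D (b :: l)

/-- Number of letters followed by a smaller letter. -/
def numDescents : List ℕ → ℕ
  | [] => 0
  | [_] => 0
  | a :: b :: l => (if b < a then 1 else 0) + numDescents (b :: l)

lemma numDescents_cons_le (a : ℕ) (l : List ℕ) : numDescents (a :: l) ≤ l.length := by
  induction l generalizing a with
  | nil => simp [numDescents]
  | cons b l ih =>
    have := ih b
    simp only [numDescents, List.length_cons]
    split_ifs <;> omega

lemma Cz_pascal (a b : ℤ) (ha : 0 ≤ a) : Cz a b + Cz a (b - 1) = Cz (a + 1) b := by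
  lift a to ℕ using ha
  unfold Cz
  rcases lt_trichotomy b 0 with hb | rfl | hb
  · rw [if_neg (by omega), if_neg (by omega), if_neg (by omega)]; rfl
  · rw [if_pos (by omega), if_neg (by omega), if_pos (by omega)]; simp
  · obtain ⟨b, rfl⟩ : ∃ c : ℕ, b = c + 1 := ⟨(b - 1).toNat, by omega⟩
    have e1 : ((b : ℤ) + 1).toNat = b + 1 := by omega
    have e2 : ((a : ℤ) + 1).toNat = a + 1 := by omega
    have e3 : ((b : ℤ) + 1 - 1).toNat = b := by omega
    rw [e1, e2, e3, Int.toNat_natCast, Nat.choose_succ_succ]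
    by_cases h : b + 1 ≤ a
    · rw [if_pos (by omega), if_pos (by omega), if_pos (by omega)]; push_cast; ring
    · rw [if_neg (by omega), Nat.choose_eq_zero_of_lt (by omega : a < b + 1)]
      by_cases h' : b ≤ a
      · rw [if_pos (by omega), if_pos (by omega)]; simp
      · rw [if_neg (by omega), if_neg (by omega)]; simp

lemma Cz_self_add (a b : ℤ) (ha : 0 ≤ a) (hb : 0 ≤ b) :
    Cz a (a + b) = if b = 0 then 1 else 0 := by
  unfold Cz
  split_ifs with h1 h2 h2
  · subst h2; simp
  · omega
  · omega
  · rfl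

lemma Cz_neg_right (a b : ℤ) (ha : 0 ≤ a) (hb : 0 ≤ b) :
    Cz a (-b) = if b = 0 then 1 else 0 := by
  unfold Cz
  split_ifs with h1 h2 h2
  · subst h2; simp
  · omega
  · omega
  · rfl

lemma shuffles_nil_left (v : List ℕ) : shuffles [] v = [v] := by
  simp [shuffles]

lemma shuffles_nil_right (u : List ℕ) : shuffles u [] = [u] := by
  cases u <;> simp [shuffles]

lemma shuffles_cons_cons (a b : ℕ) (u v : List ℕ) :
    shuffles (a :: u) (b :: v) =
      (shuffles u (b :: v)).map (a :: ·) ++ (shuffles (a :: u) v).map (b :: ·) := by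
  rw [shuffles]

/-- Number of letters of the word lying in `D`. -/
def cnt (D : Finset ℕ) (l : List ℕ) : ℕ := l.countP (fun x => decide (x ∈ D))

lemma cnt_cons (D : Finset ℕ) (a : ℕ) (l : List ℕ) :
    cnt D (a :: l) = cnt D l + if a ∈ D then 1 else 0 := by
  simp [cnt, List.countP_cons]

lemma numDescents_le_cnt (D : Finset ℕ) (l : List ℕ) (h : descentsWithin D l = true) :
    numDescents l ≤ cnt D l := by
  induction l with
  | nil => simp [numDescents]
  | cons a l ih =>
    cases l with
    | nil => simp [numDescents]
    | cons b l =>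
      simp only [descentsWithin, Bool.and_eq_true, decide_eq_true_eq] at h
      have := ih h.2
      rw [cnt_cons]
      simp only [numDescents]
      have := h.1
      split_ifs <;> first | omega | tauto

lemma cnt_le_numDescents (D : Finset ℕ) (l : List ℕ) (h : descentsCover D l = true) :
    cnt D l ≤ numDescents l := by
  induction l with
  | nil => simp [cnt]
  | cons a l ih =>
    cases l with
    | nil => simpa [numDescents, descentsCover, cnt] using h
    | cons b l =>
      simp only [descentsCover, Bool.and_eq_true, decide_eq_true_eq] at h
      have := ih h.2
      rw [cnt_cons]
      simp only [numDescents]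
      have := h.1
      split_ifs <;> first | omega | tauto

lemma goodWord_iff_descentsWithin (D : Finset ℕ) (l : List ℕ) :
    goodWord D l = true ↔ descentsWithin D l = true ∧ (cnt D l : ℤ) - numDescents l = 0 := by
  induction l with
  | nil => simp [goodWord, descentsWithin, cnt, numDescents]
  | cons a l ih =>
    cases l with
    | nil => simp [goodWord, descentsWithin, cnt, numDescents]
    | cons b l =>
      have key := numDescents_le_cnt D (b :: l)
      rw [cnt_cons]
      simp only [goodWord, descentsWithin, numDescents, Bool.and_eq_true, decide_eq_true_eq, ih]
      by_cases h1 : b < a <;> by_cases h2 : a ∈ D <;> simp [h1, h2] <;> grind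

lemma goodWord_iff_descentsCover (D : Finset ℕ) (l : List ℕ) :
    goodWord D l = true ↔ descentsCover D l = true ∧ (numDescents l : ℤ) - cnt D l = 0 := by
  induction l with
  | nil => simp [goodWord, descentsCover, cnt, numDescents]
  | cons a l ih =>
    cases l with
    | nil =>
      simp only [goodWord, descentsCover, cnt, numDescents]
      simp +contextual
    | cons b l =>
      have key := cnt_le_numDescents D (b :: l)
      rw [cnt_cons]
      simp only [goodWord, descentsCover, numDescents, Bool.and_eq_true, decide_eq_true_eq, ih]
      by_cases h1 : b < a <;> by_cases h2 : a ∈ D <;> simp [h1, h2] <;> grind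

/-- Number of shuffles `w` of `u` and `v` such that `a :: w` is good. -/
def goodCount (D : Finset ℕ) (a : ℕ) (u v : List ℕ) : ℤ :=
  ((shuffles u v).countP (fun w => goodWord D (a :: w)) : ℤ)

lemma countP_map_cons (D : Finset ℕ) (a b : ℕ) (L : List (List ℕ)) :
    ((L.map (b :: ·)).countP (fun w => goodWord D (a :: w)) : ℤ)
      = if (b < a ↔ a ∈ D) then (L.countP (fun w => goodWord D (b :: w)) : ℤ) else 0 := by
  rw [List.countP_map]
  split_ifs with h
  · congr 2; funext w; simp [goodWord, h]
  · norm_cast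
    rw [List.countP_eq_zero]
    intro w _
    simp [goodWord, h]

lemma goodCount_cons_cons (D : Finset ℕ) (a b c : ℕ) (u v : List ℕ) :
    goodCount D a (b :: u) (c :: v) =
      (if (b < a ↔ a ∈ D) then goodCount D b u (c :: v) else 0) +
      (if (c < a ↔ a ∈ D) then goodCount D c (b :: u) v else 0) := by
  unfold goodCount
  rw [shuffles_cons_cons, List.countP_append, Nat.cast_add, countP_map_cons, countP_map_cons]

lemma goodCount_nil_left (D : Finset ℕ) (a : ℕ) (v : List ℕ) :
    goodCount D a [] v = if goodWord D (a :: v) then 1 else 0 := by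
  simp [goodCount, shuffles_nil_left, List.countP_cons]

lemma goodCount_nil_right (D : Finset ℕ) (a : ℕ) (u : List ℕ) :
    goodCount D a u [] = if goodWord D (a :: u) then 1 else 0 := by
  simp [goodCount, shuffles_nil_right, List.countP_cons]

lemma goodCount_eq (D : Finset ℕ) (p : ℕ) (k : ℕ) : ∀ u v : List ℕ, u.length + v.length = k →
    (∀ x ∈ u, x < p) → (∀ y ∈ v, p ≤ y) →
    (∀ a < p, v ≠ [] → goodCount D a u v =
      if descentsCover D (a :: u) && descentsWithin D v then
        Cz (u.length - numDescents (a :: u) + numDescents v)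
          (cnt D (a :: u) + cnt D v - numDescents (a :: u)) else 0) ∧
    (∀ c, p ≤ c → u ≠ [] → goodCount D c u v =
      if descentsCover D u && descentsWithin D (c :: v) then
        Cz (u.length - 1 - numDescents u + numDescents (c :: v))
          (cnt D u + cnt D (c :: v) - numDescents u - 1) else 0) := by
  induction k with
  | zero =>
    intro u v h _ _
    have hu : u = [] := List.length_eq_zero_iff.1 (by omega)
    have hv : v = [] := List.length_eq_zero_iff.1 (by omega)
    subst hu hv
    simp
  | succ k ih =>
    intro u v h hu hv
    refine ⟨fun a ha hv0 => ?_, fun c hc hu0 => ?_⟩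
    · obtain ⟨c, v, rfl⟩ := List.exists_cons_of_ne_nil hv0
      have hac : ¬ c < a := by have := hv c (by simp); omega
      cases u with
      | nil =>
        rw [goodCount_nil_left]
        have hw := goodWord_iff_descentsWithin D (c :: v)
        have hle := numDescents_le_cnt D (c :: v)
        have hz := Cz_self_add (numDescents (c :: v)) (cnt D (c :: v) - numDescents (c :: v))
          (by omega)
        by_cases had : a ∈ D <;> by_cases hwi : descentsWithin D (c :: v) = true
        · simp [goodWord, descentsCover, had, hac]
        · simp [goodWord, descentsCover, had, hac]
        · have hz := hz (by have := hle hwi; omega)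
          simp only [add_sub_cancel] at hz
          have hna : cnt D [a] = 0 := by simp [cnt, had]
          simp [goodWord, descentsCover, had, hac, hwi, hna, numDescents, hz, hw]
        · simp [goodWord, descentsCover, had, hac, hwi, hw]
      | cons b u =>
        have hb : b < p := hu b (by simp)
        have hcp : p ≤ c := hv c (by simp)
        have h1 := (ih u (c :: v) (by simp at h ⊢; omega)
          (fun x hx => hu x (by simp [hx])) hv).1 b hb (by simp)
        have h2 := (ih (b :: u) v (by simp at h ⊢; omega)
          hu (fun x hx => hv x (by simp [hx]))).2 c hcp (by simp)
        rw [goodCount_cons_cons, h1, h2, cnt_cons D a]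
        have hn := numDescents_cons_le b u
        have hp := Cz_pascal (u.length - numDescents (b :: u) + numDescents (c :: v))
          (cnt D (b :: u) + cnt D (c :: v) - numDescents (b :: u)) (by omega)
        cases hX : descentsCover D (b :: u) <;> cases hY : descentsWithin D (c :: v) <;>
          by_cases h1 : b < a <;> by_cases h2 : a ∈ D <;>
          simp [hX, h1, h2, hac, descentsCover, numDescents] <;> try ring_nf
        all_goals (ring_nf at hp; exact hp)
    · obtain ⟨b, u, rfl⟩ := List.exists_cons_of_ne_nil hu0
      have hbc : b < c := by have := hu b (by simp); omega
      cases v with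
      | nil =>
        rw [goodCount_nil_right]
        have hw := goodWord_iff_descentsCover D (b :: u)
        have hle := cnt_le_numDescents D (b :: u)
        have hn := numDescents_cons_le b u
        have hz := Cz_neg_right (u.length - numDescents (b :: u))
          (numDescents (b :: u) - cnt D (b :: u)) (by omega)
        by_cases hcd : c ∈ D <;> by_cases hwi : descentsCover D (b :: u) = true
        · have hz := hz (by have := hle hwi; omega)
          have hna : cnt D [c] = 1 := by simp [cnt, hcd]
          simp only [neg_sub] at hz
          simp only [goodWord, hbc, hcd, descentsWithin, hwi, hna, numDescents]
          have e : (cnt D (b :: u) : ℤ) + 1 - numDescents (b :: u) - 1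
            = cnt D (b :: u) - numDescents (b :: u) := by ring
          simp [e, hz, hw, hwi]
        · simp [goodWord, hcd, hbc, hwi, hw]
        · have hna : cnt D [c] = 0 := by simp [cnt, hcd]
          have := hle hwi
          simp only [goodWord, hbc, hcd, descentsWithin, hwi, hna, numDescents]
          simp [Cz]
          omega
        · simp [goodWord, hcd, hbc, hwi]
      | cons d v =>
        have hb : b < p := hu b (by simp)
        have hdp : p ≤ d := hv d (by simp)
        have h1 := (ih u (d :: v) (by simp at h ⊢; omega)
          (fun x hx => hu x (by simp [hx])) hv).1 b hb (by simp)
        have h2 := (ih (b :: u) v (by simp at h ⊢; omega)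
          hu (fun x hx => hv x (by simp [hx]))).2 d hdp (by simp)
        rw [goodCount_cons_cons, h1, h2, cnt_cons D c]
        have hn := numDescents_cons_le b u
        have hp := Cz_pascal (u.length - numDescents (b :: u) + numDescents (d :: v))
          (cnt D (b :: u) + cnt D (d :: v) - numDescents (b :: u)) (by omega)
        cases hX : descentsCover D (b :: u) <;> cases hY : descentsWithin D (d :: v) <;>
          by_cases h1 : d < c <;> by_cases h2 : c ∈ D <;>
          simp [hY, h1, h2, hbc, descentsWithin, numDescents] <;> try ring_nf
        all_goals (ring_nf at hp; exact hp)

lemma countP_goodWord_shuffles (D : Finset ℕ) (p : ℕ) (u v : List ℕ) (hu0 : u ≠ []) (hv0 : v ≠ [])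
    (hu : ∀ x ∈ u, x < p) (hv : ∀ y ∈ v, p ≤ y) :
    ((shuffles u v).countP (goodWord D) : ℤ) =
      if descentsCover D u && descentsWithin D v then
        Cz (u.length - numDescents u + numDescents v) (cnt D u + cnt D v - numDescents u)
      else 0 := by
  obtain ⟨b, u, rfl⟩ := List.exists_cons_of_ne_nil hu0
  obtain ⟨c, v, rfl⟩ := List.exists_cons_of_ne_nil hv0
  have h1 := (goodCount_eq D p _ u (c :: v) rfl
    (fun x hx => hu x (by simp [hx])) hv).1 b (hu b (by simp)) (by simp)
  have h2 := (goodCount_eq D p _ (b :: u) v rfl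
    hu (fun x hx => hv x (by simp [hx]))).2 c (hv c (by simp)) (by simp)
  have hn := numDescents_cons_le b u
  have hp := Cz_pascal (u.length - numDescents (b :: u) + numDescents (c :: v))
    (cnt D (b :: u) + cnt D (c :: v) - numDescents (b :: u)) (by omega)
  rw [shuffles_cons_cons, List.countP_append, List.countP_map, List.countP_map, Nat.cast_add]
  change goodCount D b u (c :: v) + goodCount D c (b :: u) v = _
  rw [h1, h2]
  split_ifs
  · push_cast [List.length_cons]
    ring_nf at hp ⊢
    exact hp
  · rfl

lemma descSetC_nil : descSetC [] = ∅ := by simp [descSetC]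

lemma descSetC_singleton (a : ℕ) : descSetC [a] = ∅ := by simp [descSetC]

lemma scanl_add_eq_map (l : List ℕ) (a : ℕ) :
    l.scanl (· + ·) a = (l.scanl (· + ·) 0).map (a + ·) := by
  induction l generalizing a with
  | nil => simp
  | cons b l ih =>
    rw [List.scanl_cons, List.scanl_cons, ih (a + b), ih (0 + b)]
    simp [Function.comp_def, add_assoc]

/-- The nonempty partial sums of a list. -/
def partialSums : List ℕ → List ℕ
  | [] => []
  | a :: l => a :: (partialSums l).map (a + ·)

lemma scanl_add_zero (l : List ℕ) : l.scanl (· + ·) 0 = 0 :: partialSums l := by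
  induction l with
  | nil => simp [partialSums]
  | cons a l ih =>
    rw [List.scanl_cons, scanl_add_eq_map, ih]
    simp [partialSums]

lemma partialSums_append (A B : List ℕ) :
    partialSums (A ++ B) = partialSums A ++ (partialSums B).map (A.sum + ·) := by
  induction A with
  | nil => simp [partialSums]
  | cons a A ih => simp [partialSums, ih, Function.comp_def, add_assoc]

lemma descSetC_eq (l : List ℕ) : descSetC l = (partialSums l).dropLast.toFinset := by
  rw [descSetC, scanl_add_zero, List.tail_cons]

lemma partialSums_ne_nil {l : List ℕ} (h : l ≠ []) : partialSums l ≠ [] := by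
  cases l <;> simp_all [partialSums]

lemma partialSums_dropLast_append {l : List ℕ} (h : l ≠ []) :
    (partialSums l).dropLast ++ [l.sum] = partialSums l := by
  obtain ⟨A, b, rfl⟩ := List.eq_nil_or_concat' l |>.resolve_left h
  simp [partialSums_append, partialSums]

lemma partialSums_toFinset {l : List ℕ} (h : l ≠ []) :
    (partialSums l).toFinset = insert l.sum (descSetC l) := by
  rw [← partialSums_dropLast_append h, descSetC_eq]
  ext; simp

lemma descSetC_append {A B : List ℕ} (hA : A ≠ []) (hB : B ≠ []) :
    descSetC (A ++ B) = descSetC A ∪ {A.sum} ∪ (descSetC B).image (A.sum + ·) := by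
  rw [descSetC_eq, partialSums_append,
    List.dropLast_append_of_ne_nil (by simpa using partialSums_ne_nil hB),
    List.toFinset_append, partialSums_toFinset hA, ← List.map_dropLast, descSetC_eq B]
  ext
  simp only [Finset.mem_union, List.mem_toFinset, List.mem_map, Finset.mem_image,
    Finset.mem_insert, Finset.mem_singleton]
  tauto

lemma partialSums_add_head (A : List ℕ) (b c : ℕ) (B : List ℕ) :
    partialSums (A ++ (b + c) :: B) =
      partialSums A ++ (partialSums (c :: B)).map ((A.sum + b) + ·) := by
  simp [partialSums_append, partialSums, Function.comp_def, add_assoc]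

lemma descSetC_nearConcat {A B : List ℕ} (hA : A ≠ []) (hB : B ≠ []) :
    descSetC (nearConcat A B) = descSetC A ∪ (descSetC B).image (A.sum + ·) := by
  obtain ⟨A, b, rfl⟩ := List.eq_nil_or_concat' A |>.resolve_left hA
  obtain ⟨c, B, rfl⟩ := List.exists_cons_of_ne_nil hB
  have e : nearConcat (A ++ [b]) (c :: B) = A ++ (b + c) :: B := by simp [nearConcat]
  rw [e, descSetC_eq, partialSums_add_head,
    List.dropLast_append_of_ne_nil (by simp [partialSums]),
    List.toFinset_append, ← List.map_dropLast, descSetC_eq (c :: B), descSetC_eq (A ++ [b]),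
    partialSums_append, List.dropLast_append_of_ne_nil (by simp [partialSums])]
  ext
  simp [-List.map_dropLast, partialSums]

lemma partialSums_pos {l : List ℕ} (h : ∀ i ∈ l, 0 < i) : ∀ x ∈ partialSums l, 0 < x := by
  cases l with
  | nil => simp [partialSums]
  | cons a l =>
    have := h a (by simp)
    intro x hx
    simp [partialSums] at hx
    rcases hx with rfl | ⟨y, _, rfl⟩ <;> omega

lemma partialSums_sorted {l : List ℕ} (h : ∀ i ∈ l, 0 < i) : (partialSums l).Pairwise (· < ·) := by
  induction l with
  | nil => simp [partialSums]
  | cons a l ih =>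
    have hl : ∀ i ∈ l, 0 < i := fun i hi => h i (by simp [hi])
    have := partialSums_pos hl
    simp only [partialSums, List.pairwise_cons, List.pairwise_map]
    exact ⟨by simpa using this, (ih hl).imp (by simp)⟩

lemma zipWith_sub_partialSums (l : List ℕ) (a : ℕ) :
    List.zipWith (fun a b => a - b) ((partialSums l).map (a + ·))
      (a :: (partialSums l).map (a + ·)) = l := by
  induction l generalizing a with
  | nil => simp [partialSums]
  | cons b l ih =>
    have := ih (a + b)
    simp only [partialSums, List.map_cons, List.zipWith_cons_cons, List.map_map]
    simp only [Function.comp_def, ← add_assoc]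
    rw [this]
    simp

lemma compOfDescSet_descSetC {N : ℕ} {K : List ℕ} (hK : IsComp N K) :
    compOfDescSet N (descSetC K) = K := by
  obtain ⟨hpos, hsum⟩ := hK
  rcases eq_or_ne K [] with rfl | hne
  · simp at hsum
    subst hsum
    simp [descSetC_nil, compOfDescSet]
  have hs := partialSums_sorted hpos
  have hsd : (partialSums K).dropLast.Pairwise (· < ·) := hs.sublist (List.dropLast_sublist _)
  have hsort : (descSetC K).sort (· ≤ ·) = (partialSums K).dropLast := by
    rw [descSetC_eq]
    apply (List.toFinset_sort (· ≤ ·) (hsd.imp (fun h => ne_of_lt h))).2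
    exact hsd.imp le_of_lt
  have hz := zipWith_sub_partialSums K 0
  simp only [zero_add, List.map_id'] at hz
  unfold compOfDescSet
  rw [hsort, ← hsum, partialSums_dropLast_append hne]
  simp only [hz]
  rw [List.filter_eq_self]
  simpa using hpos

lemma descSetC_subset {N : ℕ} {K : List ℕ} (hK : IsComp N K) : descSetC K ⊆ Finset.Ioo 0 N := by
  obtain ⟨hpos, rfl⟩ := hK
  rcases eq_or_ne K [] with rfl | hne
  · simp [descSetC_nil]
  intro x hx
  rw [descSetC_eq, List.mem_toFinset] at hx
  have hs := partialSums_sorted hpos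
  rw [← partialSums_dropLast_append hne, List.pairwise_append] at hs
  rw [Finset.mem_Ioo]
  exact ⟨partialSums_pos hpos x (List.mem_of_mem_dropLast hx), hs.2.2 x hx _ (by simp)⟩

lemma partialSums_length (l : List ℕ) : (partialSums l).length = l.length := by
  induction l <;> simp_all [partialSums]

lemma length_eq_card_descSetC {N : ℕ} {K : List ℕ} (hK : IsComp N K) (hN : 0 < N) :
    K.length = (descSetC K).card + 1 := by
  obtain ⟨hpos, hsum⟩ := hK
  have hne : K ≠ [] := by rintro rfl; simp at hsum; omega
  have := List.length_pos_of_ne_nil hne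
  rw [descSetC_eq, List.toFinset_card_of_nodup]
  · rw [List.length_dropLast, partialSums_length]; omega
  · exact ((partialSums_sorted hpos).sublist (List.dropLast_sublist _)).imp (fun h => ne_of_lt h)

lemma exists_isComp_descSetC_eq (D : Finset ℕ) :
    ∀ N, 0 < N → D ⊆ Finset.Ioo 0 N → ∃ K, IsComp N K ∧ descSetC K = D := by
  induction D using Finset.induction_on_max with
  | empty => exact fun N hN _ => ⟨[N], ⟨by simpa using hN, by simp⟩, descSetC_singleton N⟩
  | insert a s hmax ih =>
    intro N hN hD
    have ha := Finset.mem_Ioo.1 (hD (Finset.mem_insert_self a s))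
    obtain ⟨K, ⟨hpos, hsum⟩, hdes⟩ := ih a ha.1 (fun x hx => Finset.mem_Ioo.2
      ⟨(Finset.mem_Ioo.1 (hD (Finset.mem_insert_of_mem hx))).1, hmax x hx⟩)
    have hne : K ≠ [] := by rintro rfl; simp at hsum; omega
    refine ⟨K ++ [N - a], ⟨?_, ?_⟩, ?_⟩
    · intro i hi
      simp at hi
      rcases hi with hi | rfl
      · exact hpos i hi
      · omega
    · simp [hsum]; omega
    · rw [descSetC_append hne (by simp), hdes, hsum, descSetC_singleton]
      ext; simp

lemma compOfDescSet_spec {N : ℕ} {D : Finset ℕ} (hD : D ⊆ Finset.Ioo 0 N) :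
    IsComp N (compOfDescSet N D) ∧ descSetC (compOfDescSet N D) = D := by
  rcases Nat.eq_zero_or_pos N with rfl | hN
  · obtain rfl : D = ∅ := by simpa using hD
    simp [compOfDescSet, descSetC_nil, IsComp]
  · obtain ⟨K, hK, rfl⟩ := exists_isComp_descSetC_eq D N hN hD
    rw [compOfDescSet_descSetC hK]
    exact ⟨hK, rfl⟩

lemma IsComp.eq_of_descSetC_eq {N : ℕ} {A B : List ℕ} (hA : IsComp N A) (hB : IsComp N B)
    (h : descSetC A = descSetC B) : A = B := by
  rw [← compOfDescSet_descSetC hA, h, compOfDescSet_descSetC hB]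

lemma IsComp.eq_nil {A : List ℕ} (hA : IsComp 0 A) : A = [] := by
  rcases A with _ | ⟨a, A⟩
  · rfl
  · have := hA.1 a (by simp)
    have := hA.2
    simp at this
    omega

lemma IsComp.ne_nil {N : ℕ} {A : List ℕ} (hA : IsComp N A) (hN : 0 < N) : A ≠ [] := by
  rintro rfl
  have := hA.2
  simp at this
  omega

lemma IsComp.length_le_of_subset {N : ℕ} {A B : List ℕ} (hA : IsComp N A) (hB : IsComp N B)
    (h : descSetC A ⊆ descSetC B) : A.length ≤ B.length := by
  rcases Nat.eq_zero_or_pos N with rfl | hN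
  · simp [hA.eq_nil]
  · rw [length_eq_card_descSetC hA hN, length_eq_card_descSetC hB hN]
    have := Finset.card_le_card h
    omega

lemma IsComp.eq_of_subset {N : ℕ} {A B : List ℕ} (hA : IsComp N A) (hB : IsComp N B)
    (h : descSetC A ⊆ descSetC B) (hl : B.length ≤ A.length) : A = B := by
  rcases Nat.eq_zero_or_pos N with rfl | hN
  · rw [hA.eq_nil, hB.eq_nil]
  · rw [length_eq_card_descSetC hA hN, length_eq_card_descSetC hB hN] at hl
    exact hA.eq_of_descSetC_eq hB (Finset.eq_of_subset_of_card_le h (by omega))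

lemma IsComp.length_le {N : ℕ} {A : List ℕ} (hA : IsComp N A) : A.length ≤ N := by
  rw [← hA.2]
  simpa using List.card_nsmul_le_sum A 1 hA.1

lemma GDes_nil : GDes [] = ∅ := by simp [GDes]

lemma GDes_singleton (a : ℕ) : GDes [a] = ∅ := by simp [GDes]

lemma GDes_cons_cons (a b : ℕ) (l : List ℕ) :
    GDes (a :: b :: l) = if b < a then insert a (GDes (b :: l)) else GDes (b :: l) := by
  have e : GDes (a :: b :: l) = (if b < a then {a} else ∅) ∪ GDes (b :: l) := by
    unfold GDes
    ext x
    simp only [Finset.mem_image, Finset.mem_filter, Finset.mem_union, Finset.mem_range]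
    constructor
    · rintro ⟨_ | i, ⟨_, h2, h3⟩, rfl⟩
      · left; simp at h3; simp [h3]
      · right; exact ⟨i, ⟨by simp at h2 ⊢; omega, by simpa using h2, by simpa using h3⟩, by simp⟩
    · rintro (h | ⟨i, ⟨hi, h2, h3⟩, rfl⟩)
      · split_ifs at h with hb
        · simp at h; subst h
          exact ⟨0, ⟨by simp, by simp, by simpa using hb⟩, by simp⟩
        · simp at h
      · exact ⟨i + 1, ⟨by simpa using hi, by simpa using h2, by simpa using h3⟩, by simp⟩
  rw [e]
  split_ifs <;> ext <;> simp

lemma GDes_subset (l : List ℕ) : GDes l ⊆ l.toFinset := by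
  induction l with
  | nil => simp [GDes_nil]
  | cons a l ih =>
    cases l with
    | nil => simp [GDes_singleton]
    | cons b l =>
      rw [GDes_cons_cons]
      intro x hx
      have := @ih x
      split_ifs at hx <;> simp at * <;> tauto

lemma one_lt_of_mem_GDes {l : List ℕ} (hl : ∀ x ∈ l, 0 < x) : ∀ x ∈ GDes l, 1 < x := by
  induction l with
  | nil => simp [GDes_nil]
  | cons a l ih =>
    cases l with
    | nil => simp [GDes_singleton]
    | cons b l =>
      have ih' := ih (fun x hx => hl x (by simp [hx]))
      have hb := hl b (by simp)
      rw [GDes_cons_cons]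
      intro x hx
      split_ifs at hx
      · rcases Finset.mem_insert.1 hx with rfl | h
        · omega
        · exact ih' x h
      · exact ih' x hx

lemma GDes_map_add (l : List ℕ) (m : ℕ) : GDes (l.map (· + m)) = (GDes l).image (· + m) := by
  induction l with
  | nil => simp [GDes_nil]
  | cons a l ih =>
    cases l with
    | nil => simp [GDes_singleton]
    | cons b l =>
      simp only [List.map_cons, GDes_cons_cons] at ih ⊢
      rw [ih]
      split_ifs <;> simp_all

lemma head_mem_GDes_iff {a b : ℕ} {l : List ℕ} (h : (a :: b :: l).Nodup) :
    a ∈ GDes (a :: b :: l) ↔ b < a := by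
  have hn : a ∉ GDes (b :: l) := fun hm =>
    (List.nodup_cons.1 h).1 (List.mem_toFinset.1 (GDes_subset _ hm))
  rw [GDes_cons_cons]
  split_ifs with hb <;> simp [hn, hb]

lemma mem_GDes_cons_iff {a x : ℕ} {l : List ℕ} (h : (a :: l).Nodup) (hx : x ∈ l) :
    x ∈ GDes (a :: l) ↔ x ∈ GDes l := by
  have hne : x ≠ a := by rintro rfl; exact (List.nodup_cons.1 h).1 hx
  cases l with
  | nil => simp at hx
  | cons b l =>
    rw [GDes_cons_cons]
    split_ifs <;> simp [hne]

lemma forall_mem_cons_cons_GDes {P : ℕ → Prop → Prop} {a b : ℕ} {l : List ℕ}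
    (h : (a :: b :: l).Nodup) :
    (∀ x ∈ a :: b :: l, P x (x ∈ GDes (a :: b :: l))) ↔
      P a (b < a) ∧ ∀ x ∈ b :: l, P x (x ∈ GDes (b :: l)) := by
  rw [List.forall_mem_cons, head_mem_GDes_iff h]
  refine and_congr_right fun _ => forall₂_congr fun x hx => ?_
  rw [mem_GDes_cons_iff h hx]

lemma goodWord_iff {D : Finset ℕ} {l : List ℕ} (h : l.Nodup) :
    goodWord D l = true ↔ ∀ x ∈ l, (x ∈ GDes l ↔ x ∈ D) := by
  induction l with
  | nil => simp [goodWord]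
  | cons a l ih =>
    cases l with
    | nil => simp [goodWord, GDes_singleton]
    | cons b l =>
      rw [forall_mem_cons_cons_GDes (P := fun x q => (q ↔ x ∈ D)) h, ← ih h.of_cons]
      simp [goodWord]

lemma descentsCover_iff {D : Finset ℕ} {l : List ℕ} (h : l.Nodup) :
    descentsCover D l = true ↔ ∀ x ∈ l, (x ∈ D → x ∈ GDes l) := by
  induction l with
  | nil => simp [descentsCover]
  | cons a l ih =>
    cases l with
    | nil => simp [descentsCover, GDes_singleton]
    | cons b l =>
      rw [forall_mem_cons_cons_GDes (P := fun x q => (x ∈ D → q)) h, ← ih h.of_cons]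
      simp only [descentsCover, Bool.and_eq_true, decide_eq_true_eq]

lemma descentsWithin_iff {D : Finset ℕ} {l : List ℕ} (h : l.Nodup) :
    descentsWithin D l = true ↔ ∀ x ∈ l, (x ∈ GDes l → x ∈ D) := by
  induction l with
  | nil => simp [descentsWithin]
  | cons a l ih =>
    cases l with
    | nil => simp [descentsWithin, GDes_singleton]
    | cons b l =>
      rw [forall_mem_cons_cons_GDes (P := fun x q => (q → x ∈ D)) h, ← ih h.of_cons]
      simp only [descentsWithin, Bool.and_eq_true, decide_eq_true_eq]

lemma numDescents_eq_card {l : List ℕ} (h : l.Nodup) : numDescents l = (GDes l).card := by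
  induction l with
  | nil => simp [numDescents, GDes_nil]
  | cons a l ih =>
    cases l with
    | nil => simp [numDescents, GDes_singleton]
    | cons b l =>
      have hn : a ∉ GDes (b :: l) := fun hm =>
        (List.nodup_cons.1 h).1 (List.mem_toFinset.1 (GDes_subset _ hm))
      rw [GDes_cons_cons, numDescents, ih h.of_cons]
      split_ifs
      · rw [Finset.card_insert_of_notMem hn, add_comm]
      · simp

lemma cnt_eq_card {D : Finset ℕ} {l : List ℕ} (h : l.Nodup) (hD : ∀ x ∈ D, x ∈ l) :
    cnt D l = D.card := by
  rw [cnt, List.countP_eq_length_filter, ← List.toFinset_card_of_nodup (h.filter _)]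
  congr 1
  ext x
  simpa using hD x

lemma perm_of_mem_shuffles {w : List ℕ} (u v : List ℕ) (hw : w ∈ shuffles u v) :
    w.Perm (u ++ v) := by
  induction u, v using shuffles.induct generalizing w with
  | case1 v => simp_all [shuffles_nil_left]
  | case2 u => simp_all [shuffles_nil_right]
  | case3 a u b v ih1 ih2 =>
    rw [shuffles_cons_cons, List.mem_append, List.mem_map, List.mem_map] at hw
    rcases hw with ⟨w, hw, rfl⟩ | ⟨w, hw, rfl⟩
    · exact (ih1 hw).cons a
    · exact ((ih2 hw).cons b).trans List.perm_middle.symm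

lemma mem_iff_of_perm_range' {N : ℕ} {l : List ℕ} (hl : l.Perm (List.range' 1 N)) (x : ℕ) :
    x ∈ l ↔ 0 < x ∧ x ≤ N := by
  rw [hl.mem_iff, List.mem_range'_1]
  omega

lemma GComp_spec {N : ℕ} {l : List ℕ} (hl : l.Perm (List.range' 1 N)) :
    IsComp N (GComp N l) ∧ GDes l = (descSetC (GComp N l)).image (· + 1) := by
  have hone := one_lt_of_mem_GDes (l := l) fun x hx => ((mem_iff_of_perm_range' hl x).1 hx).1
  have hsub : (GDes l).image (· - 1) ⊆ Finset.Ioo 0 N := by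
    intro y hy
    obtain ⟨x, hx, rfl⟩ := Finset.mem_image.1 hy
    have h1 := hone x hx
    have h2 := (mem_iff_of_perm_range' hl x).1 (List.mem_toFinset.1 (GDes_subset l hx))
    rw [Finset.mem_Ioo]
    omega
  obtain ⟨hc, hd⟩ := compOfDescSet_spec hsub
  refine ⟨hc, ?_⟩
  rw [GComp, hd, Finset.image_image, Finset.image_congr (g := id), Finset.image_id]
  intro x hx
  have := hone x hx
  simp only [Function.comp_apply, id]
  omega

lemma card_GDes {N : ℕ} {l : List ℕ} (hl : l.Perm (List.range' 1 N)) :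
    (GDes l).card = (descSetC (GComp N l)).card := by
  conv_lhs => rw [(GComp_spec hl).2]
  exact Finset.card_image_of_injective _ (add_left_injective 1)

lemma nodup_of_perm_range' {N : ℕ} {l : List ℕ} (hl : l.Perm (List.range' 1 N)) : l.Nodup :=
  hl.nodup_iff.2 List.nodup_range'

lemma mem_of_mem_image_descSetC {N : ℕ} {l K : List ℕ} (hl : l.Perm (List.range' 1 N))
    (hK : IsComp N K) : ∀ x ∈ (descSetC K).image (· + 1), x ∈ l := by
  intro x hx
  obtain ⟨y, hy, rfl⟩ := Finset.mem_image.1 hx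
  have := Finset.mem_Ioo.1 (descSetC_subset hK hy)
  rw [mem_iff_of_perm_range' hl]
  omega

lemma GComp_eq_iff {N : ℕ} {l K : List ℕ} (hl : l.Perm (List.range' 1 N)) (hK : IsComp N K) :
    GComp N l = K ↔ goodWord ((descSetC K).image (· + 1)) l = true := by
  rw [goodWord_iff (nodup_of_perm_range' hl)]
  obtain ⟨hc, hd⟩ := GComp_spec hl
  constructor
  · rintro h x -
    rw [hd, h]
  · intro h
    apply hc.eq_of_descSetC_eq hK
    apply Finset.image_injective (add_left_injective 1)
    rw [← hd]
    ext x
    exact ⟨fun hx => (h x (List.mem_toFinset.1 (GDes_subset l hx))).1 hx,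
      fun hx => (h x (mem_of_mem_image_descSetC hl hK x hx)).2 hx⟩

lemma append_map_add_perm_range' {m n : ℕ} {σ τ : List ℕ} (hσ : σ.Perm (List.range' 1 m))
    (hτ : τ.Perm (List.range' 1 n)) :
    (σ ++ τ.map (· + m)).Perm (List.range' 1 (m + n)) := by
  rw [← List.range'_append_1 (s := 1) (m := m) (n := n)]
  refine hσ.append ((hτ.map _).trans (List.Perm.of_eq ?_))
  have := List.map_add_range' (a := m) (s := 1) (n := n) (step := 1)
  rw [add_comm 1 m, ← this]
  simp [add_comm]

lemma countP_GComp_eq {m n : ℕ} {σ τ K : List ℕ} (hσ : σ.Perm (List.range' 1 m))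
    (hτ : τ.Perm (List.range' 1 n)) (hK : IsComp (m + n) K) :
    (shiftShuffle m σ τ).countP (fun μ => decide (GComp (m + n) μ = K)) =
      (shuffles σ (τ.map (· + m))).countP (goodWord ((descSetC K).image (· + 1))) := by
  apply List.countP_congr
  intro μ hμ
  have hp := (perm_of_mem_shuffles _ _ hμ).trans (append_map_add_perm_range' hσ hτ)
  rw [decide_eq_true_eq, GComp_eq_iff hp hK]

lemma ite_eq_ite_Cz_of_zero {n : ℕ} {J K : List ℕ} (hJ : IsComp n J) (hK : IsComp n K) :
    (if J = K then (1 : ℤ) else 0) =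
      if descSetC J ⊆ descSetC K then Cz (J.length) (K.length) else 0 := by
  by_cases hs : descSetC J ⊆ descSetC K
  · rw [if_pos hs]
    have h1 := hJ.length_le_of_subset hK hs
    have hz := Cz_self_add J.length (K.length - J.length) (by omega) (by omega)
    rw [add_sub_cancel] at hz
    rw [hz]
    congr 1
    exact propext ⟨fun h => by simp [h], fun h => hJ.eq_of_subset hK hs (by omega)⟩
  · rw [if_neg hs, if_neg (by rintro rfl; exact hs subset_rfl)]

lemma ite_eq_ite_Cz_of_le {m : ℕ} {I K : List ℕ} (hI : IsComp m I) (hK : IsComp m K) :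
    (if I = K then (1 : ℤ) else 0) =
      if descSetC K ⊆ descSetC I then Cz (m - I.length) (K.length - I.length) else 0 := by
  by_cases hs : descSetC K ⊆ descSetC I
  · rw [if_pos hs]
    have h1 := hK.length_le_of_subset hI hs
    have h2 := hI.length_le
    have hz := Cz_neg_right (m - I.length) (I.length - K.length) (by omega) (by omega)
    rw [neg_sub] at hz
    rw [hz]
    congr 1
    exact propext ⟨fun h => by simp [h], fun h => (hK.eq_of_subset hI hs (by omega)).symm⟩
  · rw [if_neg hs, if_neg (by rintro rfl; exact hs subset_rfl)]

lemma eq_right_of_split_nil {K K'' : List ℕ} {n : ℕ} (hK : IsComp n K)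
    (hsplit : K = [] ++ K'' ∨ K = nearConcat [] K'') : K = K'' := by
  rcases hsplit with rfl | rfl
  · rfl
  · cases K'' with
    | nil => simpa [nearConcat] using hK.1
    | cons a l => simp [nearConcat]

lemma eq_left_of_split_nil {K K' : List ℕ} {n : ℕ} (hK : IsComp n K)
    (hsplit : K = K' ++ [] ∨ K = nearConcat K' []) : K = K' := by
  rcases hsplit with rfl | rfl
  · simp
  · rcases List.eq_nil_or_concat' K' with rfl | ⟨A, b, rfl⟩
    · simpa [nearConcat] using hK.1
    · simp [nearConcat]

lemma mem_descSetC_split {m n : ℕ} {K K' K'' : List ℕ} (hm : 0 < m) (hn : 0 < n)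
    (hK' : IsComp m K') (hK'' : IsComp n K'') (hsplit : K = K' ++ K'' ∨ K = nearConcat K' K'') :
    (∀ y < m, y ∈ descSetC K ↔ y ∈ descSetC K') ∧
      ∀ y, 0 < y → (y + m ∈ descSetC K ↔ y ∈ descSetC K'') := by
  have h1 := fun y hy => Finset.mem_Ioo.1 (@descSetC_subset m K' hK' y hy)
  have h2 := fun y hy => Finset.mem_Ioo.1 (@descSetC_subset n K'' hK'' y hy)
  rcases hsplit with rfl | rfl
  · rw [descSetC_append (hK'.ne_nil hm) (hK''.ne_nil hn), hK'.2]
    simp only [Finset.mem_union, Finset.mem_singleton, Finset.mem_image]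
    grind
  · rw [descSetC_nearConcat (hK'.ne_nil hm) (hK''.ne_nil hn), hK'.2]
    simp only [Finset.mem_union, Finset.mem_image]
    grind

/-- Theorem 4.1: the number of permutations `μ` in the shifted shuffle `σ ⋒ τ`
with `GC(μ) = K` is `C(m + ℓ(J) − ℓ(I), ℓ(K) − ℓ(I))` if `K'` is coarser than
`I` and `K''` is finer than `J`, and `0` otherwise. -/
theorem stmt7 (m n : ℕ) (σ τ : List ℕ) (I J K K' K'' : List ℕ)
    (hσ : σ.Perm (List.range' 1 m)) (hτ : τ.Perm (List.range' 1 n))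
    (hI : GComp m σ = I) (hJ : GComp n τ = J)
    (hK : IsComp (m + n) K) (hK' : IsComp m K') (hK'' : IsComp n K'')
    (hsplit : K = K' ++ K'' ∨ K = nearConcat K' K'') :
    ((shiftShuffle m σ τ).countP (fun μ => decide (GComp (m + n) μ = K)) : ℤ)
      = if descSetC K' ⊆ descSetC I ∧ descSetC J ⊆ descSetC K''
        then Cz ((m : ℤ) + J.length - I.length) ((K.length : ℤ) - I.length)
        else 0 := by
  have hcount := countP_GComp_eq hσ hτ hK
  have hIc := GComp_spec hσ
  have hJc := GComp_spec hτ
  rw [hI] at hIc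
  rw [hJ] at hJc
  rcases Nat.eq_zero_or_pos m with rfl | hm
  · obtain rfl := hK'.eq_nil
    obtain rfl := hIc.1.eq_nil
    obtain rfl : σ = [] := by simpa using hσ
    obtain rfl := eq_right_of_split_nil hK hsplit
    have := ite_eq_ite_Cz_of_zero hJc.1 hK''
    simpa [shiftShuffle, shuffles_nil_left, hJ, descSetC_nil, List.countP_cons] using this
  rcases Nat.eq_zero_or_pos n with rfl | hn
  · obtain rfl := hK''.eq_nil
    obtain rfl := hJc.1.eq_nil
    obtain rfl : τ = [] := by simpa using hτ
    obtain rfl := eq_left_of_split_nil hK hsplit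
    have := ite_eq_ite_Cz_of_le hIc.1 hK'
    simpa [shiftShuffle, shuffles_nil_right, hI, descSetC_nil, List.countP_cons] using this
  have hσl : σ.length = m := by simpa using hσ.length_eq
  have hτl : τ.length = n := by simpa using hτ.length_eq
  have hσm := mem_iff_of_perm_range' hσ
  have hτm := mem_iff_of_perm_range' hτ
  have hσn := nodup_of_perm_range' hσ
  have hτn : (τ.map (· + m)).Nodup :=
    (nodup_of_perm_range' hτ).map (add_left_injective m)
  rw [hcount, countP_goodWord_shuffles _ (m + 1) _ _ (by rintro rfl; simp at hσl; omega)
    (by intro h; simp at h; subst h; simp at hτl; omega)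
    (fun x hx => by have := (hσm x).1 hx; omega)
    (fun y hy => by
      obtain ⟨x, hx, rfl⟩ := List.mem_map.1 hy
      have := (hτm x).1 hx
      omega)]
  obtain ⟨hlo, hhi⟩ := mem_descSetC_split hm hn hK' hK'' hsplit
  have hcover : descentsCover ((descSetC K).image (· + 1)) σ = true ↔
      descSetC K' ⊆ descSetC I := by
    rw [descentsCover_iff hσn, hIc.2]
    constructor
    · intro h y hy
      have hb := Finset.mem_Ioo.1 (descSetC_subset hK' hy)
      simpa using h (y + 1) ((hσm _).2 (by omega)) (by simpa using (hlo y hb.2).2 hy)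
    · intro h x hx hxD
      obtain ⟨y, hy, rfl⟩ := Finset.mem_image.1 hxD
      have hb := (hσm _).1 hx
      exact Finset.mem_image_of_mem _ (h ((hlo y (by omega)).1 hy))
  have hwithin : descentsWithin ((descSetC K).image (· + 1)) (τ.map (· + m)) = true ↔
      descSetC J ⊆ descSetC K'' := by
    rw [descentsWithin_iff hτn, GDes_map_add, hJc.2]
    have hb := fun y hy => Finset.mem_Ioo.1 (@descSetC_subset n J hJc.1 y hy)
    constructor
    · intro h y hy
      have := hb y hy
      have h' := h (y + 1 + m) (List.mem_map_of_mem ((hτm _).2 (by omega)))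
        (Finset.mem_image_of_mem _ (Finset.mem_image_of_mem _ hy))
      obtain ⟨z, hz, hzy⟩ := Finset.mem_image.1 h'
      exact (hhi y this.1).1 (by convert hz using 1; omega)
    · intro h x hx hxD
      obtain ⟨z, hz, rfl⟩ := Finset.mem_image.1 hxD
      obtain ⟨y, hy, rfl⟩ := Finset.mem_image.1 hz
      have := (hhi y (hb y hy).1).2 (h hy)
      exact Finset.mem_image.2 ⟨_, this, by omega⟩
  have hperm := append_map_add_perm_range' hσ hτ
  have hcnt : cnt ((descSetC K).image (· + 1)) σ +
      cnt ((descSetC K).image (· + 1)) (τ.map (· + m)) = (descSetC K).card := by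
    rw [cnt, cnt, ← List.countP_append, ← cnt,
      cnt_eq_card (nodup_of_perm_range' hperm) (mem_of_mem_image_descSetC hperm hK),
      Finset.card_image_of_injective _ (add_left_injective 1)]
  have hKl := length_eq_card_descSetC hK (by omega)
  have hIl := length_eq_card_descSetC hIc.1 hm
  have hJl := length_eq_card_descSetC hJc.1 hn
  have hds : numDescents σ = (descSetC I).card := by
    rw [numDescents_eq_card hσn, card_GDes hσ, hI]
  have hdt : numDescents (τ.map (· + m)) = (descSetC J).card := by
    rw [numDescents_eq_card hτn, GDes_map_add,
      Finset.card_image_of_injective _ (add_left_injective m), card_GDes hτ, hJ]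
  simp only [Bool.and_eq_true, hcover, hwithin]
  congr 2 <;> omega
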